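/- Let b > 0 be a real number with b ≠ 1 and n ≥ 1 an integer. Then (√b − 1)^{2n} < det(V_n(b)). -/

import Mathlib

open Real Matrix Finset

noncomputable def V (b : ℝ) (n : ℕ) : Matrix (Fin n) (Fin n) ℝ :=
  Matrix.of fun i j =>
    if (i : ℕ) = (j : ℕ) then b + 1
    else if (j : ℕ) = (i : ℕ) + 1 then 1
    else if (i : ℕ) = (j : ℕ) + 1 then b
    else 0

lemma det_V_succ_succ (b : ℝ) (n : ℕ) :
    (V b (n + 2)).det = (b + 1) * (V b (n + 1)).det - b * (V b n).det := by
  have shift : (V b (n + 2)).submatrix Fin.succ (Fin.succAbove 0) = V b (n + 1) := by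
    ext i j
    simp [V]
  have minor : ((V b (n + 2)).submatrix Fin.succ (Fin.succAbove 1)).det = b * (V b n).det := by
    have shift_two : ((V b (n + 2)).submatrix Fin.succ (Fin.succAbove 1)).submatrix
        (Fin.succAbove 0) Fin.succ = V b n := by
      ext i j
      simp [V, Fin.one_succAbove_succ]
    rw [det_succ_column_zero, Fin.sum_univ_succ, shift_two, Finset.sum_eq_zero]
    · simp [V]
    · intro i _
      simp [V]
  rw [det_succ_row_zero, Fin.sum_univ_succ, Fin.sum_univ_succ, shift, Fin.succ_zero_eq_one,
    minor, Finset.sum_eq_zero]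
  · simp [V]
    ring
  · intro i _
    simp [V]

lemma det_V (b : ℝ) (n : ℕ) : (V b n).det = ∑ k ∈ Finset.range (n + 1), b ^ k := by
  induction n using Nat.twoStepInduction with
  | zero => simp
  | one => simp [V, Finset.sum_range_succ, add_comm]
  | more n ih ih' =>
    rw [det_V_succ_succ, ih, ih', Finset.sum_range_succ _ (n + 2),
      Finset.sum_range_succ _ (n + 1)]
    ring

theorem stmt13 (b : ℝ) (hb : 0 < b) (hb1 : b ≠ 1) (n : ℕ) (hn : 1 ≤ n) :
    (Real.sqrt b - 1) ^ (2 * n) < (V b n).det := by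
  have hn0 : n ≠ 0 := by omega
  have hs : 0 < √b := Real.sqrt_pos.mpr hb
  have hsq : √b ^ 2 = b := Real.sq_sqrt hb.le
  have term_le (m : ℕ) (hm : m ∈ Finset.range (n + 1)) :
      b ^ m ≤ ∑ k ∈ Finset.range (n + 1), b ^ k :=
    Finset.single_le_sum (f := fun k => b ^ k) (fun k _ => (pow_pos hb k).le) hm
  rw [det_V, pow_mul]
  rcases lt_or_gt_of_ne hb1 with h | h
  · have hlt : (√b - 1) ^ 2 < 1 := by nlinarith
    calc ((√b - 1) ^ 2) ^ n < 1 := pow_lt_one₀ (sq_nonneg _) hlt hn0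
      _ = b ^ 0 := (pow_zero b).symm
      _ ≤ _ := term_le 0 (by simp)
  · have hlt : (√b - 1) ^ 2 < b := by nlinarith
    calc ((√b - 1) ^ 2) ^ n < b ^ n := pow_lt_pow_left₀ hlt (sq_nonneg _) hn0
      _ ≤ _ := term_le n (by simp)
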